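/- Let D be a finite set of positive integers with t = Max(D) (with Max(∅) = 0). Then lim_{f→∞} μ(N(D,f)) exists and equals A_D · 4^(−t) − Σ_{k=t+1}^{∞} A_{D∪{k}} · 4^(−k). -/

import Mathlib

open Filter Topology Set

/-- A numerical set: a cofinite subset of ℕ containing 0, not all of ℕ. -/
def IsNumericalSet (T : Set ℕ) : Prop :=
  0 ∈ T ∧ Tᶜ.Finite ∧ Tᶜ.Nonempty

/-- A numerical semigroup: a numerical set closed under addition. -/
def IsNumericalSemigroup (S : Set ℕ) : Prop :=
  IsNumericalSet S ∧ ∀ a ∈ S, ∀ b ∈ S, a + b ∈ S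

/-- Frobenius number: the largest element of the complement. -/
noncomputable def frob (T : Set ℕ) : ℕ := sSup Tᶜ

/-- The associated semigroup `A(T) = {t | t + T ⊆ T}`. -/
def AT (T : Set ℕ) : Set ℕ := {t : ℕ | ∀ x ∈ T, t + x ∈ T}

/-- Multiplicity: the smallest positive element. -/
noncomputable def mult (S : Set ℕ) : ℕ := sInf {x | x ∈ S ∧ 0 < x}

/-- `R(S) = f(S) - m(S)` as an integer. -/
noncomputable def RVal (S : Set ℕ) : ℤ := (frob S : ℤ) - (mult S : ℤ)

/-- `P(S)`: the number of numerical sets whose associated semigroup is `S`. -/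
noncomputable def PCount (S : Set ℕ) : ℕ :=
  {T : Set ℕ | IsNumericalSet T ∧ AT T = S}.ncard

/-- The density `μ(S) = P(S) / 2^(f(S)-1)`. -/
noncomputable def density (S : Set ℕ) : ℝ :=
  (PCount S : ℝ) / 2 ^ (frob S - 1)

/-- The numerical semigroup `N(D,f) = {0} ∪ {f - l : l ∈ D} ∪ (f, ∞)`. -/
def NSet (D : Finset ℕ) (f : ℕ) : Set ℕ :=
  {0} ∪ (fun l => f - l) '' (D : Set ℕ) ∪ {x | f < x}

/-- `B(D,f)`: numerical sets `T` with `f(T) = f` and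
`A(T) ∩ [f - Max D, f - 1] = {f - l : l ∈ D}`. -/
def BSet (D : Finset ℕ) (f : ℕ) : Set (Set ℕ) :=
  {T | IsNumericalSet T ∧ frob T = f ∧
    AT T ∩ Set.Icc (f - D.sup id) (f - 1) = (fun l => f - l) '' (D : Set ℕ)}

/-- `A_D = |B(D, 2 Max D + 1)|`. -/
noncomputable def AConst (D : Finset ℕ) : ℕ :=
  (BSet D (2 * D.sup id + 1)).ncard

/-- `B_l(k,f) = {T ∈ B({k},f) : T ∩ [1,l] = ∅}`. -/
def BlSet (l k f : ℕ) : Set (Set ℕ) :=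
  {T | T ∈ BSet {k} f ∧ T ∩ Set.Icc 1 l = ∅}

/-- `C_{l,k}`. -/
noncomputable def CConst (l k : ℕ) : ℕ :=
  if l ≤ k then (BlSet l k (2 * k + 1)).ncard else (BlSet l k (l + k + 1)).ncard

/-- `G_l(f) = {T : A(T) = N_f, T ∩ [1,l] = ∅}`. -/
def GSet (l f : ℕ) : Set (Set ℕ) :=
  {T | IsNumericalSet T ∧ AT T = NSet ∅ f ∧ T ∩ Set.Icc 1 l = ∅}

/-- The set `{0} ∪ X ∪ (f, ∞)`. -/
def withTail (f : ℕ) (X : Finset ℕ) : Set ℕ := {0} ∪ (X : Set ℕ) ∪ {x | f < x}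

open Classical in
/-- The `l` with `0 < l < f` such that `f - l` lies in the associated semigroup of
`withTail f X`. -/
noncomputable def coGaps (f : ℕ) (X : Finset ℕ) : Finset ℕ :=
  (Finset.Ioo 0 f).filter fun l => f - l ∈ AT (withTail f X)

/-- The `X ⊆ (0, f)` whose `coGaps` agree with `D` on `[1, m]`. -/
noncomputable def level (f m : ℕ) (D : Finset ℕ) : Finset (Finset ℕ) :=
  (Finset.Ioo 0 f).powerset.filter fun X => coGaps f X ∩ Finset.Icc 1 m = D

lemma mem_withTail {f x : ℕ} {X : Finset ℕ} : x ∈ withTail f X ↔ x = 0 ∨ x ∈ X ∨ f < x := by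
  simp [withTail, or_assoc]

lemma mem_coGaps {f l : ℕ} {X : Finset ℕ} :
    l ∈ coGaps f X ↔ (0 < l ∧ l < f) ∧ f - l ∈ AT (withTail f X) := by
  simp [coGaps]

lemma mem_level {f m : ℕ} {D X : Finset ℕ} :
    X ∈ level f m D ↔ X ⊆ Finset.Ioo 0 f ∧ coGaps f X ∩ Finset.Icc 1 m = D := by
  simp [level]

lemma AT_subset {T : Set ℕ} (h0 : 0 ∈ T) : AT T ⊆ T := fun x hx => by simpa using hx 0 h0

lemma zero_mem_AT (T : Set ℕ) : 0 ∈ AT T := fun x hx => by simpa using hx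

lemma add_mem_AT {T : Set ℕ} {a b : ℕ} (ha : a ∈ AT T) (hb : b ∈ AT T) : a + b ∈ AT T :=
  fun x hx => by rw [add_assoc]; exact ha _ (hb x hx)

lemma mem_of_frob_lt {T : Set ℕ} (hT : IsNumericalSet T) {x : ℕ} (hx : frob T < x) : x ∈ T := by
  by_contra h
  exact absurd (le_csSup hT.2.1.bddAbove h) (not_le.2 hx)

lemma frob_notMem {T : Set ℕ} (hT : IsNumericalSet T) : frob T ∉ T :=
  Nat.sSup_mem hT.2.2 hT.2.1.bddAbove

lemma mem_AT_of_frob_lt {T : Set ℕ} (hT : IsNumericalSet T) {x : ℕ} (hx : frob T < x) :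
    x ∈ AT T := fun y _ => mem_of_frob_lt hT (by omega)

lemma frob_eq_of {T : Set ℕ} {f : ℕ} (hf : f ∉ T) (h : ∀ x, f < x → x ∈ T) : frob T = f := by
  have hg : IsGreatest Tᶜ f := ⟨hf, fun x hx => by
    by_contra hlt
    exact hx (h x (not_le.1 hlt))⟩
  exact hg.csSup_eq

lemma frob_AT {T : Set ℕ} (hT : IsNumericalSet T) : frob (AT T) = frob T :=
  frob_eq_of (fun h => frob_notMem hT (AT_subset hT.1 h)) fun _ hx => mem_AT_of_frob_lt hT hx

lemma self_notMem_withTail {f : ℕ} (hf : 0 < f) {X : Finset ℕ} (hX : X ⊆ Finset.Ioo 0 f) :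
    f ∉ withTail f X := by
  rw [mem_withTail]
  rintro (h | h | h)
  · omega
  · simpa using hX h
  · omega

lemma isNumericalSet_withTail {f : ℕ} (hf : 0 < f) {X : Finset ℕ} (hX : X ⊆ Finset.Ioo 0 f) :
    IsNumericalSet (withTail f X) := by
  refine ⟨mem_withTail.2 (Or.inl rfl), (Set.finite_Iic f).subset fun x hx => ?_,
    ⟨f, self_notMem_withTail hf hX⟩⟩
  by_contra h
  exact hx (mem_withTail.2 (Or.inr (Or.inr (not_le.1 h))))

lemma frob_withTail {f : ℕ} (hf : 0 < f) {X : Finset ℕ} (hX : X ⊆ Finset.Ioo 0 f) :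
    frob (withTail f X) = f :=
  frob_eq_of (self_notMem_withTail hf hX) fun _ hx => mem_withTail.2 (Or.inr (Or.inr hx))

lemma exists_eq_withTail {T : Set ℕ} (hT : IsNumericalSet T) :
    ∃ X ⊆ Finset.Ioo 0 (frob T), withTail (frob T) X = T := by
  classical
  refine ⟨(Finset.Ioo 0 (frob T)).filter (· ∈ T), Finset.filter_subset _ _, ?_⟩
  ext x
  simp only [mem_withTail, Finset.mem_filter, Finset.mem_Ioo]
  constructor
  · rintro (rfl | h | h)
    exacts [hT.1, h.2, mem_of_frob_lt hT h]
  · intro hx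
    have : x ≠ frob T := fun h => frob_notMem hT (h ▸ hx)
    rcases Nat.eq_zero_or_pos x with h0 | h0
    · exact Or.inl h0
    · rcases lt_or_gt_of_ne this with h | h
      exacts [Or.inr (Or.inl ⟨⟨h0, h⟩, hx⟩), Or.inr (Or.inr h)]

lemma withTail_injOn (f : ℕ) :
    Set.InjOn (withTail f) {X : Finset ℕ | X ⊆ Finset.Ioo 0 f} := by
  intro X hX Y hY h
  ext x
  have hx := Set.ext_iff.1 h x
  simp only [mem_withTail] at hx
  constructor
  · intro hm
    have := Finset.mem_Ioo.1 (hX hm)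
    rcases hx.1 (Or.inr (Or.inl hm)) with h | h | h
    exacts [by omega, h, by omega]
  · intro hm
    have := Finset.mem_Ioo.1 (hY hm)
    rcases hx.2 (Or.inr (Or.inl hm)) with h | h | h
    exacts [by omega, h, by omega]

lemma ncard_eq_card_level {f m : ℕ} (hf : 0 < f) {D : Finset ℕ} {P : Set ℕ → Prop}
    (hP : ∀ X ⊆ Finset.Ioo 0 f, P (withTail f X) ↔ coGaps f X ∩ Finset.Icc 1 m = D) :
    {T : Set ℕ | IsNumericalSet T ∧ frob T = f ∧ P T}.ncard = (level f m D).card := by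
  have himage : {T : Set ℕ | IsNumericalSet T ∧ frob T = f ∧ P T} =
      withTail f '' (level f m D : Set (Finset ℕ)) := by
    ext T
    constructor
    · rintro ⟨hT, rfl, hPT⟩
      obtain ⟨X, hX, hXT⟩ := exists_eq_withTail hT
      exact ⟨X, mem_level.2 ⟨hX, (hP X hX).1 (hXT.symm ▸ hPT)⟩, hXT⟩
    · rintro ⟨X, hX, rfl⟩
      obtain ⟨hX, h⟩ := mem_level.1 hX
      exact ⟨isNumericalSet_withTail hf hX, frob_withTail hf hX, (hP X hX).2 h⟩
  rw [himage, Set.InjOn.ncard_image, Set.ncard_coe_finset]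
  exact (withTail_injOn f).mono fun X hX => (mem_level.1 hX).1

lemma AT_inter_Icc_eq_iff {f : ℕ} {D : Finset ℕ} (hD : ∀ d ∈ D, 0 < d) (hf : D.sup id < f)
    (X : Finset ℕ) :
    AT (withTail f X) ∩ Set.Icc (f - D.sup id) (f - 1) = (fun l => f - l) '' (D : Set ℕ) ↔
      coGaps f X ∩ Finset.Icc 1 (D.sup id) = D := by
  have hle : ∀ d ∈ D, d ≤ D.sup id := fun d hd => Finset.le_sup (f := id) hd
  constructor
  · intro h
    ext l
    simp only [Finset.mem_inter, mem_coGaps, Finset.mem_Icc]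
    constructor
    · rintro ⟨⟨hl, hA⟩, hl'⟩
      obtain ⟨d, hd, hdl⟩ := h.subset ⟨hA, by omega, by omega⟩
      have := hle d hd
      have hdl : f - d = f - l := hdl
      obtain rfl : d = l := by omega
      exact hd
    · intro hl
      have h1 := hle l hl
      have h2 := hD l hl
      have := h.superset ⟨l, hl, rfl⟩
      exact ⟨⟨⟨h2, by omega⟩, this.1⟩, h2, h1⟩
  · intro h
    ext x
    constructor
    · rintro ⟨hA, hx1, hx2⟩
      have : f - x ∈ D := by
        rw [← h]
        simp only [Finset.mem_inter, mem_coGaps, Finset.mem_Icc]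
        rw [Nat.sub_sub_self (by omega)]
        exact ⟨⟨by omega, hA⟩, by omega⟩
      exact ⟨f - x, this, Nat.sub_sub_self (by omega)⟩
    · rintro ⟨d, hd, rfl⟩
      have h1 := hle d hd
      have h2 := hD d hd
      rw [Finset.mem_coe, ← h] at hd
      simp only [Finset.mem_inter, mem_coGaps] at hd
      exact ⟨hd.1.2, by simp only; omega, by simp only; omega⟩

lemma ncard_BSet {f : ℕ} {D : Finset ℕ} (hD : ∀ d ∈ D, 0 < d) (hf : D.sup id < f) :
    (BSet D f).ncard = (level f (D.sup id) D).card :=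
  ncard_eq_card_level (by omega) fun X _ => AT_inter_Icc_eq_iff hD hf X

lemma AT_withTail_eq_NSet_iff {f : ℕ} {D : Finset ℕ} (hD : ∀ d ∈ D, 0 < d) (hf : D.sup id < f)
    {X : Finset ℕ} (hX : X ⊆ Finset.Ioo 0 f) :
    AT (withTail f X) = NSet D f ↔ coGaps f X ∩ Finset.Icc 1 (f - 1) = D := by
  have hle : ∀ d ∈ D, d ≤ D.sup id := fun d hd => Finset.le_sup (f := id) hd
  have hnum := isNumericalSet_withTail (by omega) hX
  have hfrob := frob_withTail (by omega) hX
  have hN : ∀ l, 0 < l → l < f → (f - l ∈ NSet D f ↔ l ∈ D) := by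
    intro l h0 hl
    simp only [NSet, Set.mem_union, Set.mem_singleton_iff, Set.mem_image, Set.mem_ofPred_eq,
      Finset.mem_coe]
    constructor
    · rintro ((h | ⟨d, hd, h⟩) | h)
      · omega
      · have := hle d hd
        obtain rfl : d = l := by omega
        exact hd
      · omega
    · exact fun h => Or.inl (Or.inr ⟨l, h, rfl⟩)
  constructor
  · intro h
    ext l
    simp only [Finset.mem_inter, mem_coGaps, Finset.mem_Icc, h]
    constructor
    · rintro ⟨⟨hl, hA⟩, -⟩
      exact (hN l hl.1 hl.2).1 hA
    · intro hl
      have h1 := hle l hl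
      have h2 := hD l hl
      exact ⟨⟨⟨h2, by omega⟩, (hN l h2 (by omega)).2 hl⟩, h2, by omega⟩
  · intro h
    ext x
    rcases Nat.eq_zero_or_pos x with rfl | h0
    · exact iff_of_true (zero_mem_AT _) (Or.inl (Or.inl rfl))
    rcases lt_trichotomy x f with hx | rfl | hx
    · have h1 := hN (f - x) (by omega) (by omega)
      rw [Nat.sub_sub_self hx.le] at h1
      rw [h1, ← h]
      simp only [Finset.mem_inter, mem_coGaps, Finset.mem_Icc]
      rw [Nat.sub_sub_self hx.le]
      exact ⟨fun h => ⟨⟨by omega, h⟩, by omega⟩, fun h => h.1.2⟩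
    · refine iff_of_false (fun h' => self_notMem_withTail h0 hX (AT_subset hnum.1 h')) ?_
      rintro ((h' | ⟨d, hd, h'⟩) | h')
      · exact absurd h' (by simpa using h0.ne')
      · have h' : x - d = x := h'
        have := hD d hd
        omega
      · exact lt_irrefl x h'
    · exact iff_of_true (mem_AT_of_frob_lt hnum (by omega)) (Or.inr hx)

lemma frob_NSet {f : ℕ} {D : Finset ℕ} (hD : ∀ d ∈ D, 0 < d) (hf : 0 < f) :
    frob (NSet D f) = f := by
  refine frob_eq_of ?_ fun x hx => Or.inr hx
  rintro ((h | ⟨d, hd, h⟩) | h)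
  · exact hf.ne' h
  · have h : f - d = f := h
    have := hD d hd
    omega
  · exact lt_irrefl f h

lemma PCount_NSet {f : ℕ} {D : Finset ℕ} (hD : ∀ d ∈ D, 0 < d) (hf : D.sup id < f) :
    PCount (NSet D f) = (level f (f - 1) D).card := by
  rw [← ncard_eq_card_level (P := fun T => AT T = NSet D f) (by omega)
    fun X hX => AT_withTail_eq_NSet_iff hD hf hX, PCount]
  congr 1
  ext T
  constructor
  · rintro ⟨h1, h2⟩
    exact ⟨h1, by rw [← frob_AT h1, h2, frob_NSet hD (by omega)], h2⟩
  · rintro ⟨h1, -, h2⟩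
    exact ⟨h1, h2⟩

lemma sup_insert_eq {D : Finset ℕ} {k : ℕ} (hk : D.sup id < k) : (insert k D).sup id = k := by
  rw [Finset.sup_insert]
  exact max_eq_left hk.le

lemma card_level_eq_add {f m : ℕ} {D : Finset ℕ} (hm : D.sup id ≤ m) :
    (level f m D).card = (level f (m + 1) D).card + (level f (m + 1) (insert (m + 1) D)).card := by
  have hmD : m + 1 ∉ D := fun h => by
    have : m + 1 ≤ D.sup id := Finset.le_sup (f := id) h
    omega
  have hIcc : Finset.Icc 1 (m + 1) = insert (m + 1) (Finset.Icc 1 m) := by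
    ext x; simp only [Finset.mem_Icc, Finset.mem_insert]; omega
  rw [← Finset.card_union_of_disjoint]
  · congr 1
    ext X
    simp only [Finset.mem_union, mem_level, ← and_or_left]
    refine and_congr_right fun _ => ?_
    rw [hIcc]
    by_cases hX : m + 1 ∈ coGaps f X
    · rw [Finset.inter_insert_of_mem hX]
      constructor
      · rintro rfl; exact Or.inr rfl
      · rintro (h | h)
        · exact absurd (h ▸ Finset.mem_insert_self _ _) hmD
        · have := congrArg (fun s => s.erase (m + 1)) h
          simpa [Finset.erase_insert hmD] using this
    · rw [Finset.inter_insert_of_notMem hX]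
      constructor
      · exact Or.inl
      · rintro (h | h)
        · exact h
        · have h' : m + 1 ∈ coGaps f X ∩ Finset.Icc 1 m := h ▸ Finset.mem_insert_self _ _
          exact absurd (Finset.mem_inter.1 h').1 hX
  · rw [Finset.disjoint_left]
    intro X h1 h2
    have h1 := (mem_level.1 h1).2
    have h2 := (mem_level.1 h2).2
    exact hmD ((h1.symm.trans h2) ▸ Finset.mem_insert_self _ _)

lemma card_level_eq_sum {f m : ℕ} {D : Finset ℕ} (hm : D.sup id ≤ m) :
    (level f (D.sup id) D).card =
      (level f m D).card + ∑ k ∈ Finset.Ioc (D.sup id) m, (level f k (insert k D)).card := by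
  induction m, hm using Nat.le_induction with
  | base => simp
  | succ m hm ih =>
    rw [ih, card_level_eq_add hm, ← Finset.insert_Ioc_right_eq_Ioc_add_one hm,
      Finset.sum_insert (by simp)]
    ring

lemma mem_coGaps_iff {f l : ℕ} {X : Finset ℕ} (hX : X ⊆ Finset.Ioo 0 f) (hl : 0 < l)
    (hlf : l < f) :
    l ∈ coGaps f X ↔ l ∉ X ∧ f - l ∈ X ∧ ∀ x ∈ X, x < l → f - (l - x) ∈ X := by
  have hXf : ∀ x ∈ X, 0 < x ∧ x < f := fun x hx => Finset.mem_Ioo.1 (hX hx)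
  rw [mem_coGaps]
  simp only [hl, hlf, true_and, and_true]
  constructor
  · intro h
    have key : ∀ x, (x = 0 ∨ x ∈ X) → x ≤ l → x ≠ l ∧ f - (l - x) ∈ X := by
      intro x hx hxl
      have h1 := mem_withTail.1 (h x (mem_withTail.2 (hx.imp_right Or.inl)))
      rw [show f - l + x = f - (l - x) by omega] at h1
      rcases h1 with h1 | h1 | h1
      · omega
      · exact ⟨fun he => by have := hXf _ h1; omega, h1⟩
      · omega
    refine ⟨fun hm => (key l (Or.inr hm) le_rfl).1 rfl, ?_,
      fun x hx hxl => (key x (Or.inr hx) hxl.le).2⟩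
    simpa using (key 0 (Or.inl rfl) (Nat.zero_le _)).2
  · rintro ⟨h1, h2, h3⟩ x hx
    rw [mem_withTail] at hx ⊢
    rcases hx with rfl | hx | hx
    · exact Or.inr (Or.inl h2)
    · rcases lt_trichotomy x l with h | rfl | h
      · rw [show f - l + x = f - (l - x) by omega]
        exact Or.inr (Or.inl (h3 x hx h))
      · exact absurd hx h1
      · exact Or.inr (Or.inr (by omega))
    · exact Or.inr (Or.inr (by omega))

/-- Pairs of subsets of `[1, t]`, standing for the two ends `X ∩ [1, t]` and
`f - (X ∩ [f - t, f - 1])` of a set `X` in `level f t D`. -/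
noncomputable def endPairs (t : ℕ) (D : Finset ℕ) : Finset (Finset ℕ × Finset ℕ) :=
  open Classical in
  ((Finset.Icc 1 t).powerset ×ˢ (Finset.Icc 1 t).powerset).filter fun p =>
    ∀ l ∈ Finset.Icc 1 t,
      (l ∉ p.1 ∧ l ∈ p.2 ∧ ∀ x ∈ p.1, x < l → l - x ∈ p.2) ↔ l ∈ D

lemma card_level_of_two_mul_lt {f t : ℕ} {D : Finset ℕ} (hD : D ⊆ Finset.Icc 1 t)
    (hf : 2 * t < f) :
    (level f t D).card = (endPairs t D).card * 2 ^ (f - 1 - 2 * t) := by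
  classical
  have hcard : (Finset.Ioo t (f - t)).powerset.card = 2 ^ (f - 1 - 2 * t) := by
    rw [Finset.card_powerset, Nat.card_Ioo]
    congr 1
    omega
  rw [← hcard, ← Finset.card_product]
  have hlevel : ∀ X, X ∈ level f t D ↔ X ⊆ Finset.Ioo 0 f ∧ ∀ l ∈ Finset.Icc 1 t,
      (l ∉ X ∧ f - l ∈ X ∧ ∀ x ∈ X, x < l → f - (l - x) ∈ X) ↔ l ∈ D := by
    intro X
    rw [mem_level]
    refine and_congr_right fun hX => ⟨fun h l hl => ?_, fun h => ?_⟩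
    · have hl' := Finset.mem_Icc.1 hl
      rw [← mem_coGaps_iff hX (by omega) (by omega), ← h, Finset.mem_inter, and_iff_left hl]
    · ext l
      rw [Finset.mem_inter]
      by_cases hl : l ∈ Finset.Icc 1 t
      · have hl' := Finset.mem_Icc.1 hl
        rw [and_iff_left hl, mem_coGaps_iff hX (by omega) (by omega), h l hl]
      · exact iff_of_false (fun h' => hl h'.2) fun h' => hl (hD h')
  refine Finset.card_nbij'
    (fun X => (((Finset.Icc 1 t).filter (· ∈ X), (Finset.Icc 1 t).filter (f - · ∈ X)),
      (Finset.Ioo t (f - t)).filter (· ∈ X)))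
    (fun p => (Finset.Ioo 0 f).filter fun x => x ∈ p.1.1 ∨ f - x ∈ p.1.2 ∨ x ∈ p.2)
    ?_ ?_ ?_ ?_
  · intro X hX
    obtain ⟨hX, h⟩ := (hlevel X).1 hX
    simp only [Finset.coe_product, Set.mem_prod, Finset.mem_coe, Finset.mem_powerset,
      Finset.filter_subset, and_true, endPairs, Finset.mem_filter, Finset.mem_product, true_and]
    intro l hl
    rw [← h l hl]
    have hl' := Finset.mem_Icc.1 hl
    simp only [Finset.mem_Icc, hl', true_and, and_self]
    refine and_congr_right fun _ => and_congr_right fun _ => ⟨fun h x hx hxl => ?_,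
      fun h x hx hxl => ⟨by omega, h x hx.2 hxl⟩⟩
    have := Finset.mem_Ioo.1 (hX hx)
    exact (h x ⟨by omega, hx⟩ hxl).2
  · rintro ⟨⟨L, R⟩, M⟩ hp
    simp only [Finset.coe_product, Set.mem_prod, Finset.mem_coe, Finset.mem_powerset,
      endPairs, Finset.mem_filter, Finset.mem_product] at hp
    obtain ⟨⟨⟨hL, hR⟩, h⟩, hM⟩ := hp
    rw [Finset.mem_coe, hlevel]
    refine ⟨Finset.filter_subset _ _, fun l hl => ?_⟩
    rw [← h l hl]
    have hl' := Finset.mem_Icc.1 hl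
    have hlow : ∀ x, x ≤ t → ((0 < x ∧ x < f) ∧ (x ∈ L ∨ f - x ∈ R ∨ x ∈ M) ↔ x ∈ L) := by
      refine fun x hx => ⟨?_, fun h => ?_⟩
      · rintro ⟨hx0, h | h | h⟩
        · exact h
        · have := Finset.mem_Icc.1 (hR h); omega
        · have := Finset.mem_Ioo.1 (hM h); omega
      · have := Finset.mem_Icc.1 (hL h)
        exact ⟨by omega, Or.inl h⟩
    have hhigh : ∀ x, 0 < x → x ≤ t →
        ((0 < f - x ∧ f - x < f) ∧ (f - x ∈ L ∨ f - (f - x) ∈ R ∨ f - x ∈ M) ↔ x ∈ R) := by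
      intro x hx0 hx
      rw [Nat.sub_sub_self (by omega)]
      refine ⟨?_, fun h => ⟨by omega, Or.inr (Or.inl h)⟩⟩
      rintro ⟨-, h | h | h⟩
      · have := Finset.mem_Icc.1 (hL h); omega
      · exact h
      · have := Finset.mem_Ioo.1 (hM h); omega
    simp only [Finset.mem_filter, Finset.mem_Ioo]
    rw [hlow l hl'.2, hhigh l hl'.1 hl'.2]
    refine and_congr_right fun _ => and_congr_right fun _ => ⟨fun h x hx hxl => ?_,
      fun h x hx hxl => ?_⟩
    · exact (hhigh (l - x) (by omega) (by omega)).1 (h x ((hlow x (by omega)).2 hx) hxl)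
    · exact (hhigh (l - x) (by omega) (by omega)).2 (h x ((hlow x (by omega)).1 hx) hxl)
  · intro X hX
    obtain ⟨hX, -⟩ := (hlevel X).1 hX
    ext x
    simp only [Finset.mem_filter, Finset.mem_Ioo, Finset.mem_Icc]
    constructor
    · rintro ⟨hx, h | h | h⟩
      · exact h.2
      · rw [Nat.sub_sub_self hx.2.le] at h
        exact h.2
      · exact h.2
    · intro hx
      have hxf := Finset.mem_Ioo.1 (hX hx)
      rw [Nat.sub_sub_self hxf.2.le]
      simp only [hx, and_true]
      omega
  · rintro ⟨⟨L, R⟩, M⟩ hp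
    simp only [Finset.coe_product, Set.mem_prod, Finset.mem_coe, Finset.mem_powerset,
      endPairs, Finset.mem_filter, Finset.mem_product] at hp
    obtain ⟨⟨⟨hL, hR⟩, -⟩, hM⟩ := hp
    have hL' : ∀ x ∈ L, 1 ≤ x ∧ x ≤ t := fun x hx => Finset.mem_Icc.1 (hL hx)
    have hR' : ∀ x ∈ R, 1 ≤ x ∧ x ≤ t := fun x hx => Finset.mem_Icc.1 (hR hx)
    have hM' : ∀ x ∈ M, t < x ∧ x < f - t := fun x hx => Finset.mem_Ioo.1 (hM hx)
    refine Prod.ext (Prod.ext ?_ ?_) ?_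
    · ext x
      simp only [Finset.mem_filter, Finset.mem_Ioo, Finset.mem_Icc]
      constructor
      · rintro ⟨hx, -, h | h | h⟩
        · exact h
        · have := hR' _ h; omega
        · have := hM' _ h; omega
      · intro h
        have := hL' _ h
        exact ⟨this, by omega, Or.inl h⟩
    · ext x
      simp only [Finset.mem_filter, Finset.mem_Ioo, Finset.mem_Icc]
      constructor
      · rintro ⟨hx, -, h | h | h⟩
        · have := hL' _ h; omega
        · rwa [Nat.sub_sub_self (by omega)] at h
        · have := hM' _ h; omega
      · intro h
        have := hR' _ h
        rw [Nat.sub_sub_self (by omega)]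
        exact ⟨this, by omega, Or.inr (Or.inl h)⟩
    · ext x
      simp only [Finset.mem_filter, Finset.mem_Ioo]
      constructor
      · rintro ⟨hx, -, h | h | h⟩
        · have := hL' _ h; omega
        · have := hR' _ h; omega
        · exact h
      · intro h
        have := hM' _ h
        exact ⟨this, by omega, Or.inr (Or.inr h)⟩

lemma subset_Icc_sup {D : Finset ℕ} (hD : ∀ d ∈ D, 0 < d) : D ⊆ Finset.Icc 1 (D.sup id) :=
  fun d hd => Finset.mem_Icc.2 ⟨hD d hd, Finset.le_sup (f := id) hd⟩

lemma card_level_div {f : ℕ} {D : Finset ℕ} (hD : ∀ d ∈ D, 0 < d) (hf : 2 * D.sup id < f) :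
    ((level f (D.sup id) D).card : ℝ) / 2 ^ (f - 1) =
      (AConst D : ℝ) * 4 ^ (-((D.sup id : ℕ) : ℤ)) := by
  have hA : AConst D = (endPairs (D.sup id) D).card := by
    rw [AConst, ncard_BSet hD (by omega),
      card_level_of_two_mul_lt (subset_Icc_sup hD) (by omega)]
    simp
  rw [card_level_of_two_mul_lt (subset_Icc_sup hD) hf, hA]
  have hpow : (2 : ℝ) ^ (f - 1) = 2 ^ (f - 1 - 2 * D.sup id) * 4 ^ D.sup id := by
    rw [show (4 : ℝ) = 2 ^ 2 by norm_num, ← pow_mul, ← pow_add]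
    congr 1
    omega
  rw [hpow, zpow_neg, zpow_natCast]
  push_cast
  field_simp

lemma card_filter_shift_le (s : ℕ) (I : Finset ℕ) : ∀ U : Finset ℕ,
    (∀ x ∈ I, x ∈ U ∧ x + s ∈ U) → (∀ x ∈ I, ∀ y ∈ I, x ≠ y + s) →
    4 ^ I.card * (U.powerset.filter fun X => ∀ x ∈ I, x ∈ X → x + s ∈ X).card ≤
      3 ^ I.card * 2 ^ U.card := by
  induction I using Finset.induction_on with
  | empty => intro U _ _; simp
  | insert a I ha ih =>
    intro U hU hI
    obtain ⟨haU, hasU⟩ := hU a (Finset.mem_insert_self _ _)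
    have hne : a ≠ a + s := hI a (Finset.mem_insert_self _ _) a (Finset.mem_insert_self _ _)
    set V := (U.erase a).erase (a + s) with hV
    have hVcard : U.card = V.card + 2 := by
      rw [hV, Finset.card_erase_of_mem (Finset.mem_erase.2 ⟨hne.symm, hasU⟩),
        Finset.card_erase_of_mem haU]
      have : 1 < U.card := Finset.one_lt_card.2 ⟨a, haU, a + s, hasU, hne⟩
      omega
    have hdisj : ∀ x ∈ I, x ≠ a ∧ x ≠ a + s ∧ x + s ≠ a ∧ x + s ≠ a + s := by
      intro x hx
      have hxI := Finset.mem_insert_of_mem (a := x) (b := a) hx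
      have hxa : x ≠ a := fun h => ha (h ▸ hx)
      exact ⟨hxa, hI x hxI a (Finset.mem_insert_self _ _),
        (hI a (Finset.mem_insert_self _ _) x hxI).symm, by omega⟩
    have hIV := ih V
      (fun x hx => by
        have h1 := hU x (Finset.mem_insert_of_mem hx)
        have h2 := hdisj x hx
        simp only [hV, Finset.mem_erase]
        exact ⟨⟨h2.2.1, h2.1, h1.1⟩, h2.2.2.2, h2.2.2.1, h1.2⟩)
      (fun x hx y hy => hI x (Finset.mem_insert_of_mem hx) y (Finset.mem_insert_of_mem hy))
    set F := V.powerset.filter fun X => ∀ x ∈ I, x ∈ X → x + s ∈ X with hF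
    have hsub : (U.powerset.filter fun X => ∀ x ∈ insert a I, x ∈ X → x + s ∈ X) ⊆
        F ∪ (F.image (insert (a + s)) ∪ F.image fun Y => insert a (insert (a + s) Y)) := by
      intro X hX
      obtain ⟨hXU, hX⟩ := Finset.mem_filter.1 hX
      rw [Finset.mem_powerset] at hXU
      have hY : (X.erase a).erase (a + s) ∈ F := by
        refine Finset.mem_filter.2 ⟨Finset.mem_powerset.2
          (Finset.erase_subset_erase _ (Finset.erase_subset_erase _ hXU)), fun x hx hxX => ?_⟩
        have h2 := hdisj x hx
        simp only [Finset.mem_erase] at hxX ⊢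
        exact ⟨h2.2.2.2, h2.2.2.1, hX x (Finset.mem_insert_of_mem hx) hxX.2.2⟩
      simp only [Finset.mem_union, Finset.mem_image]
      by_cases h1 : a ∈ X
      · have h2 := hX a (Finset.mem_insert_self _ _) h1
        refine Or.inr (Or.inr ⟨_, hY, ?_⟩)
        rw [Finset.insert_erase (Finset.mem_erase.2 ⟨hne.symm, h2⟩), Finset.insert_erase h1]
      · rw [Finset.erase_eq_of_notMem h1] at hY
        by_cases h2 : a + s ∈ X
        · exact Or.inr (Or.inl ⟨_, hY, Finset.insert_erase h2⟩)
        · rw [Finset.erase_eq_of_notMem h2] at hY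
          exact Or.inl hY
    have hle : (U.powerset.filter fun X => ∀ x ∈ insert a I, x ∈ X → x + s ∈ X).card ≤
        3 * F.card := by
      refine (Finset.card_le_card hsub).trans ((Finset.card_union_le _ _).trans ?_)
      have h1 := Finset.card_union_le (F.image (insert (a + s)))
        (F.image fun Y => insert a (insert (a + s) Y))
      have h2 := Finset.card_image_le (s := F) (f := insert (a + s))
      have h3 := Finset.card_image_le (s := F) (f := fun Y => insert a (insert (a + s) Y))
      omega
    rw [Finset.card_insert_of_notMem ha, hVcard]
    calc 4 ^ (I.card + 1) *
          (U.powerset.filter fun X => ∀ x ∈ insert a I, x ∈ X → x + s ∈ X).card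
        ≤ 4 ^ (I.card + 1) * (3 * F.card) := Nat.mul_le_mul_left _ hle
      _ = 12 * (4 ^ I.card * F.card) := by ring
      _ ≤ 12 * (3 ^ I.card * 2 ^ V.card) := Nat.mul_le_mul_left _ hIV
      _ = 3 ^ (I.card + 1) * 2 ^ (V.card + 2) := by ring

lemma mem_AT_and_le_of_mem_level {f k : ℕ} {D X : Finset ℕ} (hkf : k < f)
    (hX : X ∈ level f k (insert k D)) : f - k ∈ AT (withTail f X) ∧ k ≤ f - k + D.sup id := by
  obtain ⟨hX, h⟩ := mem_level.1 hX
  have hk : k ∈ coGaps f X :=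
    (Finset.mem_inter.1 (h.symm ▸ Finset.mem_insert_self k D)).1
  have hA := (mem_coGaps.1 hk).2
  refine ⟨hA, ?_⟩
  have h2 := add_mem_AT hA hA
  by_contra! hlt
  have hl : k - (f - k) ∈ insert k D := by
    rw [← h, Finset.mem_inter, mem_coGaps, Finset.mem_Icc]
    rw [show f - (k - (f - k)) = f - k + (f - k) by omega]
    exact ⟨⟨by omega, h2⟩, by omega⟩
  rcases Finset.mem_insert.1 hl with h' | h'
  · omega
  · have : k - (f - k) ≤ D.sup id := Finset.le_sup (f := id) h'
    omega

lemma card_level_insert_le {f k : ℕ} {D : Finset ℕ} (hk : D.sup id < k) (hkf : k < f) :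
    4 ^ (k - D.sup id - 1) * (level f k (insert k D)).card ≤
      3 ^ (k - D.sup id - 1) * 2 ^ (f - 1) := by
  rcases (level f k (insert k D)).eq_empty_or_nonempty with h | ⟨X₀, hX₀⟩
  · simp [h]
  have hle := (mem_AT_and_le_of_mem_level hkf hX₀).2
  have key := card_filter_shift_le (f - k) (Finset.Ioo 0 (k - D.sup id)) (Finset.Ioo 0 f)
    (fun x hx => by simp only [Finset.mem_Ioo] at hx ⊢; omega)
    (fun x hx y hy => by simp only [Finset.mem_Ioo] at hx hy; omega)
  simp only [Nat.card_Ioo, Nat.sub_zero] at key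
  refine le_trans (Nat.mul_le_mul_left _ (Finset.card_le_card fun X hX => ?_)) key
  refine Finset.mem_filter.2 ⟨Finset.mem_powerset.2 (mem_level.1 hX).1, fun x hx hxX => ?_⟩
  have h := mem_withTail.1
    ((mem_AT_and_le_of_mem_level hkf hX).1 x (mem_withTail.2 (Or.inr (Or.inl hxX))))
  rw [Finset.mem_Ioo] at hx
  rw [add_comm]
  rcases h with h | h | h
  · omega
  · exact h
  · omega

lemma card_level_insert_div_le {f k : ℕ} {D : Finset ℕ} (hk : D.sup id < k) (hkf : k < f) :
    ((level f k (insert k D)).card : ℝ) / 2 ^ (f - 1) ≤ (4 / 3) ^ (D.sup id + 1) * (3 / 4) ^ k := by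
  have h : ((4 ^ (k - D.sup id - 1) * (level f k (insert k D)).card : ℕ) : ℝ) ≤
      ((3 ^ (k - D.sup id - 1) * 2 ^ (f - 1) : ℕ) : ℝ) :=
    Nat.cast_le.2 (card_level_insert_le hk hkf)
  push_cast at h
  have hpow : (4 / 3 : ℝ) ^ (D.sup id + 1) * (3 / 4) ^ k = (3 / 4) ^ (k - D.sup id - 1) := by
    obtain ⟨j, rfl⟩ := Nat.exists_eq_add_of_lt hk
    rw [show D.sup id + j + 1 - D.sup id - 1 = j by omega,
      show D.sup id + j + 1 = (D.sup id + 1) + j by omega, pow_add _ _ j, ← mul_assoc, ← mul_pow]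
    norm_num
  rw [hpow, div_pow, div_le_div_iff₀ (by positivity) (by positivity)]
  linarith

lemma density_NSet {f : ℕ} {D : Finset ℕ} (hD : ∀ d ∈ D, 0 < d) (hf : 2 * D.sup id < f) :
    density (NSet D f) = (AConst D : ℝ) * 4 ^ (-((D.sup id : ℕ) : ℤ)) -
      ∑' k : ℕ, if D.sup id < k ∧ k < f then
        ((level f k (insert k D)).card : ℝ) / 2 ^ (f - 1) else 0 := by
  have hsum : ∑' k : ℕ, (if D.sup id < k ∧ k < f then
      ((level f k (insert k D)).card : ℝ) / 2 ^ (f - 1) else 0) =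
      ∑ k ∈ Finset.Ioc (D.sup id) (f - 1),
        ((level f k (insert k D)).card : ℝ) / 2 ^ (f - 1) := by
    rw [tsum_eq_sum (s := Finset.Ioc (D.sup id) (f - 1))]
    · refine Finset.sum_congr rfl fun k hk => if_pos ?_
      rw [Finset.mem_Ioc] at hk
      omega
    · intro k hk
      refine if_neg fun h => hk ?_
      rw [Finset.mem_Ioc]
      omega
  rw [hsum, ← card_level_div hD hf, density, frob_NSet hD (by omega), PCount_NSet hD (by omega),
    card_level_eq_sum (f := f) (m := f - 1) (by omega), ← Finset.sum_div]
  push_cast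
  ring

theorem stmt6 (D : Finset ℕ) (hD : ∀ d ∈ D, 0 < d) :
    Tendsto (fun f : ℕ => density (NSet D f)) atTop
      (nhds ((AConst D : ℝ) * 4 ^ (-((D.sup id : ℕ) : ℤ)) -
        ∑' k : ℕ,
          if D.sup id + 1 ≤ k then (AConst (insert k D) : ℝ) * 4 ^ (-(k : ℤ)) else 0)) := by
  have key : Tendsto (fun f : ℕ => ∑' k : ℕ, if D.sup id < k ∧ k < f then
      ((level f k (insert k D)).card : ℝ) / 2 ^ (f - 1) else 0) atTop
      (nhds (∑' k : ℕ,
        if D.sup id + 1 ≤ k then (AConst (insert k D) : ℝ) * 4 ^ (-(k : ℤ)) else 0)) := by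
    refine tendsto_tsum_of_dominated_convergence
      (bound := fun k => (4 / 3) ^ (D.sup id + 1) * (3 / 4) ^ k)
      ((summable_geometric_of_lt_one (by norm_num) (by norm_num)).mul_left _) (fun k => ?_)
      (Eventually.of_forall fun f k => ?_)
    · refine tendsto_const_nhds.congr' ?_
      filter_upwards [eventually_gt_atTop (2 * k)] with f hf
      by_cases hk : D.sup id < k
      · have hD' : ∀ d ∈ insert k D, 0 < d := by
          intro d hd
          rcases Finset.mem_insert.1 hd with rfl | hd
          exacts [by omega, hD d hd]
        have h := card_level_div (f := f) hD' (by rw [sup_insert_eq hk]; exact hf)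
        rw [sup_insert_eq hk] at h
        rw [if_pos (by omega), if_pos (by omega), h]
      · rw [if_neg (by omega), if_neg (by omega)]
    · split_ifs with h
      · rw [Real.norm_of_nonneg (by positivity)]
        exact card_level_insert_div_le h.1 h.2
      · rw [norm_zero]
        positivity
  refine (key.const_sub _).congr' ?_
  filter_upwards [eventually_gt_atTop (2 * D.sup id)] with f hf
  exact (density_NSet hD hf).symm
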